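/- arXiv:1602.05093 — 2 statements merged into one kernel-verified Lean document; each statement's English description precedes it below -/
import Mathlib

section
/- Estimates for the exponential of an operator in block-decay norm (Lemma 2.10, estimates (2.31) and (2.33)): Let ν ≥ 1 and s ≥ s₀. There exists a constant C = C(s, ν) > 0 such that the following holds. Let Ψ be a Töplitz-in-time 2×2 block operator with |Ψ|D||_{s₀} ≤ 1 and |Ψ|D||_s < ∞, and set Φ := exp(Ψ) = ∑_{k ≥ 0} Ψ^{∘k}/k!. Then |(Φ − Id)|D||_s ≤ C |Ψ|D||_s, and moreover the quadratic remainder Φ_{≥2} := Φ − Id − Ψ satisfies |Φ_{≥2}|D||_s ≤ C |Ψ|D||_s · |Ψ|D||_{s₀}. -/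
open scoped ENNReal NNReal BigOperators

/-- A Töplitz-in-time `2 × 2` block operator: `R ℓ j j'` is the block coupling the
space modes `±j'` to `±j` at time-Fourier index `ℓ`. -/
abbrev BlockOp (ν : ℕ) := (Fin ν → ℤ) → ℕ+ → ℕ+ → Matrix (Fin 2) (Fin 2) ℂ

/-- The weight `⟨(ℓ, m)⟩^{2s} = max(1, ‖ℓ‖_∞, |m|)^{2s}` as an extended real. -/
noncomputable def bwt (ν : ℕ) (s : ℝ) (ℓ : Fin ν → ℤ) (m : ℤ) : ℝ≥0∞ :=
  ENNReal.ofReal ((max 1 (max ‖ℓ‖ ((|m| : ℤ) : ℝ))) ^ (2 * s))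

/-- The squared Frobenius norm of a `2 × 2` complex matrix, as an extended real. -/
noncomputable def frobSq (M : Matrix (Fin 2) (Fin 2) ℂ) : ℝ≥0∞ :=
  ∑ i : Fin 2, ∑ j : Fin 2, (‖M i j‖₊ : ℝ≥0∞) ^ 2

/-- The block-decay norm
`|R|_s = sup_{j'} (∑_{ℓ, j} ⟨(ℓ, j − j')⟩^{2s} ‖R(ℓ,j,j')‖²)^{1/2}` (valued in `ℝ≥0∞`). -/
noncomputable def blockNorm {ν : ℕ} (s : ℝ) (R : BlockOp ν) : ℝ≥0∞ :=
  ⨆ j' : ℕ+, (∑' ℓ : Fin ν → ℤ, ∑' j : ℕ+,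
    bwt ν s ℓ (((j : ℕ) : ℤ) - ((j' : ℕ) : ℤ)) * frobSq (R ℓ j j')) ^ (1/2 : ℝ)

/-- Composition of Töplitz-in-time block operators:
`(R ∘ B)(ℓ, j, j') = ∑_{ℓ', k} R(ℓ − ℓ', j, k) · B(ℓ', k, j')`. -/
noncomputable def bcomp {ν : ℕ} (R B : BlockOp ν) : BlockOp ν :=
  fun ℓ j j' => ∑' q : (Fin ν → ℤ) × ℕ+, R (ℓ - q.1) j q.2 * B q.1 q.2 j'

/-- The identity block operator. -/
noncomputable def bId (ν : ℕ) : BlockOp ν :=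
  fun ℓ j j' => if ℓ = 0 ∧ j = j' then (1 : Matrix (Fin 2) (Fin 2) ℂ) else 0

/-- `bpowI R k` is the `k`-fold composition `R ∘ ⋯ ∘ R`, with `bpowI R 0 = Id`. -/
noncomputable def bpowI {ν : ℕ} (R : BlockOp ν) : ℕ → BlockOp ν
  | 0 => bId ν
  | k + 1 => bcomp R (bpowI R k)

/-- The exponential `exp(Ψ) = ∑_{k ≥ 0} Ψ^{∘k}/k!` of a block operator. -/
noncomputable def bexp {ν : ℕ} (R : BlockOp ν) : BlockOp ν :=
  fun ℓ j j' => ∑' k : ℕ, ((k.factorial : ℂ)⁻¹) • (bpowI R k ℓ j j')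

/-- Pointwise difference of block operators. -/
noncomputable def bsub {ν : ℕ} (R B : BlockOp ν) : BlockOp ν :=
  fun ℓ j j' => R ℓ j j' - B ℓ j j'

/-- The right-smoothing weight `R ↦ R|D|`, multiplying the block `R(ℓ, j, j')` by `j'`. -/
noncomputable def rD {ν : ℕ} (R : BlockOp ν) : BlockOp ν :=
  fun ℓ j j' => (((j' : ℕ) : ℂ)) • R ℓ j j'

/-- `s₀ = ⌊(ν+1)/2⌋ + 1`. -/
def s0 (ν : ℕ) : ℕ := (ν + 1) / 2 + 1

/-- Weighted Cauchy–Schwarz inequality for series of extended nonnegative reals. -/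
lemma ENNReal.sq_tsum_le_of_sq_le_mul {ι : Type*} {a f g : ι → ℝ≥0∞}
    (h : ∀ i, a i ^ 2 ≤ f i * g i) : (∑' i, a i) ^ 2 ≤ (∑' i, f i) * ∑' i, g i := by
  have hroot (x y : ℝ≥0∞) (hxy : x ^ 2 ≤ y) : x ≤ y ^ (1 / 2 : ℝ) := by
    calc x = (x ^ 2) ^ (1 / 2 : ℝ) := by
          rw [← ENNReal.rpow_natCast, ← ENNReal.rpow_mul]
          norm_num
      _ ≤ y ^ (1 / 2 : ℝ) := by gcongr
  have key : ∑' i, a i ≤ ((∑' i, f i) * ∑' i, g i) ^ (1 / 2 : ℝ) := by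
    rw [ENNReal.tsum_eq_iSup_sum]
    refine iSup_le fun S => ?_
    calc ∑ i ∈ S, a i ≤ ∑ i ∈ S, f i ^ (1 / 2 : ℝ) * g i ^ (1 / 2 : ℝ) := by
          refine Finset.sum_le_sum fun i _ => ?_
          rw [← ENNReal.mul_rpow_of_nonneg _ _ (by norm_num)]
          exact hroot _ _ (h i)
      _ ≤ (∑ i ∈ S, (f i ^ (1 / 2 : ℝ)) ^ (2 : ℝ)) ^ (1 / (2 : ℝ)) *
            (∑ i ∈ S, (g i ^ (1 / 2 : ℝ)) ^ (2 : ℝ)) ^ (1 / (2 : ℝ)) :=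
          ENNReal.inner_le_Lp_mul_Lq _ _ _ Real.HolderConjugate.two_two
      _ = (∑ i ∈ S, f i) ^ (1 / 2 : ℝ) * (∑ i ∈ S, g i) ^ (1 / 2 : ℝ) := by
          simp only [← ENNReal.rpow_mul]
          norm_num
      _ ≤ ((∑' i, f i) * ∑' i, g i) ^ (1 / 2 : ℝ) := by
          rw [ENNReal.mul_rpow_of_nonneg _ _ (by norm_num)]
          gcongr <;> exact ENNReal.sum_le_tsum _
  calc (∑' i, a i) ^ 2 ≤ (((∑' i, f i) * ∑' i, g i) ^ (1 / 2 : ℝ)) ^ 2 := by gcongr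
    _ = _ := by
      rw [← ENNReal.rpow_natCast, ← ENNReal.rpow_mul]
      norm_num

/-- The entries of a (possibly divergent) series of matrices are bounded by the series of the
entries. -/
lemma Matrix.enorm_tsum_apply_le {ι m n : Type*} (M : ι → Matrix m n ℂ) (i : m) (j : n) :
    ‖(∑' q, M q) i j‖ₑ ≤ ∑' q, ‖M q i j‖ₑ := by
  by_cases hM : Summable M
  · have h : (∑' q, M q) i j = ∑' q, M q i j := by
      have h1 := Pi.hasSum.1 (Pi.hasSum.1 hM.hasSum i) j
      exact h1.tsum_eq.symm
    rw [h]
    exact enorm_tsum_le_tsum_enorm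
  · simp [tsum_eq_zero_of_not_summable hM]

lemma frobSq_tsum_le {ι : Type*} (M : ι → Matrix (Fin 2) (Fin 2) ℂ) (w : ι → ℝ≥0∞)
    (h0 : ∀ q, w q ≠ 0) (htop : ∀ q, w q ≠ ⊤) :
    frobSq (∑' q, M q) ≤ (∑' q, (w q)⁻¹) * ∑' q, w q * frobSq (M q) := by
  have hentry (i j : Fin 2) : ‖(∑' q, M q) i j‖ₑ ^ 2 ≤
      (∑' q, (w q)⁻¹) * ∑' q, w q * ‖M q i j‖ₑ ^ 2 := by
    refine (pow_le_pow_left' (Matrix.enorm_tsum_apply_le M i j) 2).trans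
      (ENNReal.sq_tsum_le_of_sq_le_mul fun q => ?_)
    rw [← mul_assoc, ENNReal.inv_mul_cancel (h0 q) (htop q), one_mul]
  calc frobSq (∑' q, M q)
      ≤ ∑ i : Fin 2, ∑ j : Fin 2, (∑' q, (w q)⁻¹) * ∑' q, w q * ‖M q i j‖ₑ ^ 2 :=
        Finset.sum_le_sum fun i _ => Finset.sum_le_sum fun j _ => hentry i j
    _ = (∑' q, (w q)⁻¹) * ∑' q, w q * frobSq (M q) := by
        simp only [frobSq, Fin.sum_univ_two, ENNReal.tsum_add, mul_add]
        rfl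

lemma frobSq_mul_le (A B : Matrix (Fin 2) (Fin 2) ℂ) :
    frobSq (A * B) ≤ frobSq A * frobSq B := by
  have hentry (i j : Fin 2) : ‖(A * B) i j‖ₑ ^ 2 ≤
      (∑ k, ‖A i k‖ₑ ^ 2) * ∑ k, ‖B k j‖ₑ ^ 2 := by
    have h1 : ‖(A * B) i j‖ₑ ≤ ∑ k, ‖A i k‖ₑ * ‖B k j‖ₑ := by
      rw [Matrix.mul_apply]
      refine (enorm_sum_le _ _).trans_eq ?_
      simp only [enorm_mul]
    refine (pow_le_pow_left' h1 2).trans ?_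
    have h2 := ENNReal.sq_tsum_le_of_sq_le_mul (a := fun k => ‖A i k‖ₑ * ‖B k j‖ₑ)
      (f := fun k => ‖A i k‖ₑ ^ 2) (g := fun k => ‖B k j‖ₑ ^ 2) fun k => (mul_pow _ _ _).le
    simpa only [tsum_fintype] using h2
  calc frobSq (A * B)
      ≤ ∑ i : Fin 2, ∑ j : Fin 2, (∑ k, ‖A i k‖ₑ ^ 2) * ∑ k, ‖B k j‖ₑ ^ 2 :=
        Finset.sum_le_sum fun i _ => Finset.sum_le_sum fun j _ => hentry i j
    _ = frobSq A * frobSq B := by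
        simp only [← Finset.sum_mul_sum]
        congr 1
        exact Finset.sum_comm

lemma frobSq_smul (c : ℂ) (M : Matrix (Fin 2) (Fin 2) ℂ) :
    frobSq (c • M) = ‖c‖ₑ ^ 2 * frobSq M := by
  have h (i j : Fin 2) : (‖(c • M) i j‖₊ : ℝ≥0∞) ^ 2 = ‖c‖ₑ ^ 2 * (‖M i j‖₊ : ℝ≥0∞) ^ 2 := by
    rw [← mul_pow]
    congr 1
    exact enorm_mul c (M i j)
  simp only [frobSq, h, Finset.mul_sum]

lemma enorm_sq_le_frobSq (M : Matrix (Fin 2) (Fin 2) ℂ) (i j : Fin 2) :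
    ‖M i j‖ₑ ^ 2 ≤ frobSq M :=
  (Finset.single_le_sum (f := fun j => ‖M i j‖ₑ ^ 2) (fun _ _ => zero_le) (Finset.mem_univ j)).trans
    (Finset.single_le_sum (f := fun i => ∑ j, ‖M i j‖ₑ ^ 2) (fun _ _ => zero_le)
      (Finset.mem_univ i))

/-! ### The weights -/

lemma one_le_bwt (ν : ℕ) {s : ℝ} (hs : 0 ≤ s) (ℓ : Fin ν → ℤ) (m : ℤ) : 1 ≤ bwt ν s ℓ m := by
  rw [bwt, ENNReal.one_le_ofReal]
  exact Real.one_le_rpow (le_max_left _ _) (by positivity)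

lemma bwt_ne_top (ν : ℕ) (s : ℝ) (ℓ : Fin ν → ℤ) (m : ℤ) : bwt ν s ℓ m ≠ ⊤ :=
  ENNReal.ofReal_ne_top

lemma bwt_add_le (ν : ℕ) {s : ℝ} (hs : 0 ≤ s) (ℓ ℓ' : Fin ν → ℤ) (m m' : ℤ) :
    bwt ν s (ℓ + ℓ') (m + m') ≤
      ENNReal.ofReal (2 ^ (2 * s)) * (bwt ν s ℓ m + bwt ν s ℓ' m') := by
  simp only [bwt]
  rw [← ENNReal.ofReal_add (by positivity) (by positivity),
    ← ENNReal.ofReal_mul (by positivity)]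
  refine ENNReal.ofReal_le_ofReal ?_
  set x : ℝ := max 1 (max ‖ℓ‖ ((|m| : ℤ) : ℝ)) with hx
  set y : ℝ := max 1 (max ‖ℓ'‖ ((|m'| : ℤ) : ℝ)) with hy
  have hx1 : 1 ≤ x := le_max_left _ _
  have hy1 : 1 ≤ y := le_max_left _ _
  have hsum : max 1 (max ‖ℓ + ℓ'‖ ((|m + m'| : ℤ) : ℝ)) ≤ x + y := by
    refine max_le (by linarith) (max_le ?_ ?_)
    · exact (norm_add_le _ _).trans (add_le_add ((le_max_left _ _).trans (le_max_right _ _))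
        ((le_max_left _ _).trans (le_max_right _ _)))
    · have h : ((|m + m'| : ℤ) : ℝ) ≤ ((|m| : ℤ) : ℝ) + ((|m'| : ℤ) : ℝ) := by
        exact_mod_cast abs_add_le m m'
      exact h.trans (add_le_add ((le_max_right _ _).trans (le_max_right _ _))
        ((le_max_right _ _).trans (le_max_right _ _)))
  have hmax : x + y ≤ 2 * max x y := by
    linarith [le_max_left x y, le_max_right x y]
  calc (max 1 (max ‖ℓ + ℓ'‖ ((|m + m'| : ℤ) : ℝ))) ^ (2 * s)
      ≤ (2 * max x y) ^ (2 * s) :=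
        Real.rpow_le_rpow (by positivity) (hsum.trans hmax) (by positivity)
    _ = 2 ^ (2 * s) * (max x y) ^ (2 * s) := Real.mul_rpow (by norm_num) (by positivity)
    _ ≤ 2 ^ (2 * s) * (x ^ (2 * s) + y ^ (2 * s)) := by
        gcongr
        rcases le_total x y with h | h
        · rw [max_eq_right h]
          exact le_add_of_nonneg_left (by positivity)
        · rw [max_eq_left h]
          exact le_add_of_nonneg_right (by positivity)

lemma ENNReal.tsum_pi_prod {α : Type*} (u : α → ℝ≥0∞) (n : ℕ) :
    ∑' x : Fin n → α, ∏ i, u (x i) = (∑' a, u a) ^ n := by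
  induction n with
  | zero => simp
  | succ n ih =>
    rw [← (Fin.consEquiv fun _ => α).tsum_eq, ENNReal.tsum_prod', pow_succ', ← ih,
      ← ENNReal.tsum_mul_right]
    refine tsum_congr fun a => ?_
    rw [← ENNReal.tsum_mul_left]
    refine tsum_congr fun x => ?_
    simp [Fin.consEquiv, Fin.prod_univ_succ]

lemma tsum_ofReal_max_one_abs_rpow_neg_ne_top {t : ℝ} (ht : 1 < t) :
    ∑' n : ℤ, ENNReal.ofReal ((max 1 |(n : ℝ)|) ^ (-t)) ≠ ⊤ := by
  have hsum : Summable fun n : ℤ => (max 1 |(n : ℝ)|) ^ (-t) := by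
    refine Summable.of_nonneg_of_le (fun n => by positivity) (fun n => ?_)
      ((Real.summable_abs_int_rpow ht).add (summable_of_hasFiniteSupport
        (f := fun n : ℤ => if n = 0 then (1 : ℝ) else 0) ?_))
    · by_cases hn : n = 0
      · subst hn
        simp
        positivity
      · have h1 : (1 : ℝ) ≤ |(n : ℝ)| := by exact_mod_cast Int.one_le_abs hn
        simp [hn, max_eq_right h1]
    · refine (Set.finite_singleton (0 : ℤ)).subset fun n hn => ?_
      by_contra h
      simp at h
      simp [h] at hn
  exact hsum.tsum_ofReal_ne_top

/-- The lattice sum `∑_{ℓ, m} ⟨(ℓ, m)⟩^{-2 s₀}` converges. -/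
lemma tsum_inv_bwt_s0_ne_top (ν : ℕ) :
    ∑' p : (Fin ν → ℤ) × ℤ, (bwt ν (s0 ν : ℕ) p.1 p.2)⁻¹ ≠ ⊤ := by
  set t : ℝ := 2 * (s0 ν : ℕ) / (ν + 1) with ht
  have ht1 : 1 < t := by
    rw [ht, one_lt_div (by positivity)]
    have : ν + 1 < 2 * s0 ν := by
      unfold s0
      omega
    exact_mod_cast this
  set u : ℤ → ℝ≥0∞ := fun n => ENNReal.ofReal ((max 1 |(n : ℝ)|) ^ (-t)) with hu
  have hle (p : (Fin ν → ℤ) × ℤ) :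
      (bwt ν (s0 ν : ℕ) p.1 p.2)⁻¹ ≤ (∏ i, u (p.1 i)) * u p.2 := by
    set x : ℝ := max 1 (max ‖p.1‖ ((|p.2| : ℤ) : ℝ)) with hx
    have hx1 : 1 ≤ x := le_max_left _ _
    have hux (n : ℤ) (hn : |(n : ℝ)| ≤ x) : ENNReal.ofReal (x ^ (-t)) ≤ u n :=
      ENNReal.ofReal_le_ofReal
        (Real.rpow_le_rpow_of_nonpos (by positivity) (max_le hx1 hn) (by linarith))
    have hpow : (bwt ν (s0 ν : ℕ) p.1 p.2)⁻¹ =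
        (∏ _i : Fin ν, ENNReal.ofReal (x ^ (-t))) * ENNReal.ofReal (x ^ (-t)) := by
      rw [bwt, ← hx, ← ENNReal.ofReal_inv_of_pos (by positivity), Finset.prod_const,
        ← pow_succ, ← ENNReal.ofReal_pow (by positivity), ← Real.rpow_natCast,
        ← Real.rpow_mul (by positivity), ← Real.rpow_neg (by positivity)]
      congr 2
      rw [ht]
      simp
      field_simp
    rw [hpow]
    refine mul_le_mul' (Finset.prod_le_prod' fun i _ => hux _ ?_) (hux _ ?_)
    · refine le_trans ?_ ((le_max_left _ _).trans (le_max_right _ _))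
      simpa [Int.norm_eq_abs] using norm_le_pi_norm p.1 i
    · refine le_trans ?_ ((le_max_right _ _).trans (le_max_right _ _))
      simp
  have hfin : ∑' n, u n ≠ ⊤ := tsum_ofReal_max_one_abs_rpow_neg_ne_top ht1
  refine ne_top_of_le_ne_top ?_ (ENNReal.tsum_le_tsum hle)
  rw [ENNReal.tsum_prod (f := fun (ℓ : Fin ν → ℤ) m => (∏ i, u (ℓ i)) * u m)]
  simp only [ENNReal.tsum_mul_left, ENNReal.tsum_mul_right, ENNReal.tsum_pi_prod]
  exact ENNReal.mul_ne_top (ENNReal.pow_ne_top hfin) hfin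

/-! ### Columns of a block operator -/

/-- The squared weighted `ℓ²` norm `∑_{ℓ, j} ⟨(ℓ, j − j')⟩^{2s} ‖R(ℓ,j,j')‖²` of the column `j'`
of a block operator. -/
noncomputable def colSq {ν : ℕ} (s : ℝ) (R : BlockOp ν) (j' : ℕ+) : ℝ≥0∞ :=
  ∑' ℓ : Fin ν → ℤ, ∑' j : ℕ+,
    bwt ν s ℓ (((j : ℕ) : ℤ) - ((j' : ℕ) : ℤ)) * frobSq (R ℓ j j')

lemma blockNorm_le_iff {ν : ℕ} {s : ℝ} {R : BlockOp ν} {c : ℝ≥0∞} :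
    blockNorm s R ≤ c ↔ ∀ j', colSq s R j' ≤ c ^ 2 := by
  refine iSup_le_iff.trans (forall_congr' fun j' => ?_)
  rw [one_div, ENNReal.rpow_inv_le_iff (by norm_num), ← ENNReal.rpow_natCast]
  rfl

lemma colSq_le_sq_blockNorm {ν : ℕ} (s : ℝ) (R : BlockOp ν) (j' : ℕ+) :
    colSq s R j' ≤ blockNorm s R ^ 2 :=
  blockNorm_le_iff.1 le_rfl j'

lemma sq_blockNorm_le {ν : ℕ} {s : ℝ} {R : BlockOp ν} {c : ℝ≥0∞} (h : ∀ j', colSq s R j' ≤ c) :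
    blockNorm s R ^ 2 ≤ c := by
  have hc : (c ^ (1 / 2 : ℝ)) ^ 2 = c := by
    rw [← ENNReal.rpow_natCast, ← ENNReal.rpow_mul]
    norm_num
  calc blockNorm s R ^ 2 ≤ (c ^ (1 / 2 : ℝ)) ^ 2 :=
        pow_le_pow_left' (blockNorm_le_iff.2 fun j' => by rw [hc]; exact h j') 2
    _ = c := hc

lemma frobSq_le_colSq {ν : ℕ} {s : ℝ} (hs : 0 ≤ s) (R : BlockOp ν) (ℓ : Fin ν → ℤ) (j j' : ℕ+) :
    frobSq (R ℓ j j') ≤ colSq s R j' :=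
  calc frobSq (R ℓ j j')
      ≤ bwt ν s ℓ (((j : ℕ) : ℤ) - ((j' : ℕ) : ℤ)) * frobSq (R ℓ j j') :=
        le_mul_of_one_le_left' (one_le_bwt ν hs _ _)
    _ ≤ ∑' j : ℕ+, bwt ν s ℓ (((j : ℕ) : ℤ) - ((j' : ℕ) : ℤ)) * frobSq (R ℓ j j') :=
        ENNReal.le_tsum j
    _ ≤ colSq s R j' := ENNReal.le_tsum (f := fun ℓ => ∑' j : ℕ+,
        bwt ν s ℓ (((j : ℕ) : ℤ) - ((j' : ℕ) : ℤ)) * frobSq (R ℓ j j')) ℓ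

lemma frobSq_le_frobSq_rD {ν : ℕ} (R : BlockOp ν) (ℓ : Fin ν → ℤ) (j j' : ℕ+) :
    frobSq (R ℓ j j') ≤ frobSq (rD R ℓ j j') := by
  rw [rD, frobSq_smul]
  refine le_mul_of_one_le_left' (one_le_pow₀ ?_)
  rw [← ofReal_norm, ENNReal.one_le_ofReal, Complex.norm_natCast]
  exact_mod_cast j'.pos

lemma blockNorm_le_blockNorm_rD {ν : ℕ} (s : ℝ) (R : BlockOp ν) :
    blockNorm s R ≤ blockNorm s (rD R) := by
  refine blockNorm_le_iff.2 fun j' => (?_ : _ ≤ _).trans (colSq_le_sq_blockNorm s (rD R) j')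
  exact ENNReal.tsum_le_tsum fun ℓ => ENNReal.tsum_le_tsum fun j =>
    mul_le_mul_right (frobSq_le_frobSq_rD R ℓ j j') _

/-! ### Composition -/

lemma rD_bcomp {ν : ℕ} (R B : BlockOp ν) : rD (bcomp R B) = bcomp R (rD B) := by
  funext ℓ j j'
  simp only [rD, bcomp, Matrix.mul_smul]
  exact (tsum_const_smul'' _).symm

lemma bcomp_bId {ν : ℕ} (R : BlockOp ν) : bcomp R (bId ν) = R := by
  funext ℓ j j'
  simp only [bcomp, bId]
  rw [tsum_eq_single ((0 : Fin ν → ℤ), j')]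
  · simp
  · rintro ⟨a, b⟩ hab
    rw [if_neg, mul_zero]
    rintro ⟨h1, h2⟩
    exact hab (Prod.ext h1 h2)

/-- The constant of the tame estimate for the composition of block operators. -/
noncomputable def bcompConst (ν : ℕ) (s : ℝ) : ℝ≥0∞ :=
  ENNReal.ofReal (2 ^ (2 * s)) * (2 * ∑' p : (Fin ν → ℤ) × ℤ, (bwt ν (s0 ν : ℕ) p.1 p.2)⁻¹)

lemma bcompConst_ne_top (ν : ℕ) (s : ℝ) : bcompConst ν s ≠ ⊤ :=
  ENNReal.mul_ne_top ENNReal.ofReal_ne_top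
    (ENNReal.mul_ne_top (by norm_num) (tsum_inv_bwt_s0_ne_top ν))

lemma bwt_add_mul_inv_le (ν : ℕ) {s : ℝ} (hs : 0 ≤ s) (s' : ℝ) (ℓ ℓ' : Fin ν → ℤ)
    (m m' : ℤ) :
    bwt ν s (ℓ + ℓ') (m + m') *
      (bwt ν s ℓ m * bwt ν s' ℓ' m' + bwt ν s' ℓ m * bwt ν s ℓ' m')⁻¹ ≤
      ENNReal.ofReal (2 ^ (2 * s)) * ((bwt ν s' ℓ' m')⁻¹ + (bwt ν s' ℓ m)⁻¹) := by
  have hne (k : Fin ν → ℤ) (n : ℤ) : bwt ν s k n ≠ 0 :=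
    (zero_lt_one.trans_le (one_le_bwt ν hs k n)).ne'
  have hcancel (a b : ℝ≥0∞) (ha : a ≠ 0) (ha' : a ≠ ⊤) : a * (a * b)⁻¹ = b⁻¹ := by
    rw [ENNReal.mul_inv (.inl ha) (.inl ha'), ← mul_assoc, ENNReal.mul_inv_cancel ha ha', one_mul]
  refine (mul_le_mul_left (bwt_add_le ν hs ℓ ℓ' m m') _).trans ?_
  rw [mul_assoc, add_mul]
  gcongr
  · rw [← hcancel (bwt ν s ℓ m) (bwt ν s' ℓ' m') (hne _ _) (bwt_ne_top _ _ _ _)]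
    gcongr
    exact le_self_add
  · rw [← hcancel (bwt ν s ℓ' m') (bwt ν s' ℓ m) (hne _ _) (bwt_ne_top _ _ _ _),
      mul_comm (bwt ν s ℓ' m') (bwt ν s' ℓ m)]
    gcongr
    exact le_add_self

lemma colSq_eq_tsum_sub {ν : ℕ} (s : ℝ) (R : BlockOp ν) (j' : ℕ+) (ℓ' : Fin ν → ℤ) :
    ∑' ℓ : Fin ν → ℤ, ∑' j : ℕ+,
      bwt ν s (ℓ - ℓ') (((j : ℕ) : ℤ) - ((j' : ℕ) : ℤ)) * frobSq (R (ℓ - ℓ') j j') =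
      colSq s R j' :=
  (Equiv.subRight ℓ').tsum_eq fun ℓ => ∑' j : ℕ+,
    bwt ν s ℓ (((j : ℕ) : ℤ) - ((j' : ℕ) : ℤ)) * frobSq (R ℓ j j')

lemma tsum_tsum_tsum_mul_le {ν : ℕ} (s s' : ℝ) (R B : BlockOp ν) (j' : ℕ+) :
    ∑' ℓ : Fin ν → ℤ, ∑' j : ℕ+, ∑' q : (Fin ν → ℤ) × ℕ+,
      (bwt ν s (ℓ - q.1) (((j : ℕ) : ℤ) - ((q.2 : ℕ) : ℤ)) * frobSq (R (ℓ - q.1) j q.2)) *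
        (bwt ν s' q.1 (((q.2 : ℕ) : ℤ) - ((j' : ℕ) : ℤ)) * frobSq (B q.1 q.2 j')) ≤
      blockNorm s R ^ 2 * blockNorm s' B ^ 2 := by
  calc _ = ∑' q : (Fin ν → ℤ) × ℕ+, colSq s R q.2 *
        (bwt ν s' q.1 (((q.2 : ℕ) : ℤ) - ((j' : ℕ) : ℤ)) * frobSq (B q.1 q.2 j')) := by
        refine (tsum_congr fun ℓ => ENNReal.tsum_comm).trans (ENNReal.tsum_comm.trans
          (tsum_congr fun q => ?_))
        simp only [ENNReal.tsum_mul_right, colSq_eq_tsum_sub]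
    _ ≤ ∑' q : (Fin ν → ℤ) × ℕ+, blockNorm s R ^ 2 *
        (bwt ν s' q.1 (((q.2 : ℕ) : ℤ) - ((j' : ℕ) : ℤ)) * frobSq (B q.1 q.2 j')) :=
        ENNReal.tsum_le_tsum fun q => mul_le_mul_left (colSq_le_sq_blockNorm s R q.2) _
    _ = blockNorm s R ^ 2 * colSq s' B j' := by
        rw [ENNReal.tsum_mul_left, ENNReal.tsum_prod (f := fun (ℓ : Fin ν → ℤ) (j : ℕ+) =>
          bwt ν s' ℓ (((j : ℕ) : ℤ) - ((j' : ℕ) : ℤ)) * frobSq (B ℓ j j'))]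
        rfl
    _ ≤ _ := mul_le_mul_right (colSq_le_sq_blockNorm s' B j') _

/-- Tame estimate for the composition of block operators, with all norms squared. -/
lemma sq_blockNorm_bcomp_le {ν : ℕ} {s : ℝ} (hs : 0 ≤ s) (R B : BlockOp ν) :
    blockNorm s (bcomp R B) ^ 2 ≤ bcompConst ν s *
      (blockNorm s R ^ 2 * blockNorm (s0 ν : ℕ) B ^ 2 +
        blockNorm (s0 ν : ℕ) R ^ 2 * blockNorm s B ^ 2) := by
  refine sq_blockNorm_le fun j' => ?_
  have hs0 : (0 : ℝ) ≤ (s0 ν : ℕ) := Nat.cast_nonneg _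
  let bR (r : ℝ) (ℓ : Fin ν → ℤ) (j : ℕ+) (q : (Fin ν → ℤ) × ℕ+) : ℝ≥0∞ :=
    bwt ν r (ℓ - q.1) (((j : ℕ) : ℤ) - ((q.2 : ℕ) : ℤ))
  let bB (r : ℝ) (q : (Fin ν → ℤ) × ℕ+) : ℝ≥0∞ := bwt ν r q.1 (((q.2 : ℕ) : ℤ) - ((j' : ℕ) : ℤ))
  let w (ℓ : Fin ν → ℤ) (j : ℕ+) (q : (Fin ν → ℤ) × ℕ+) : ℝ≥0∞ :=
    bR s ℓ j q * bB (s0 ν : ℕ) q + bR (s0 ν : ℕ) ℓ j q * bB s q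
  have hw0 (ℓ j q) : w ℓ j q ≠ 0 := by
    refine (zero_lt_one.trans_le (le_add_right ?_)).ne'
    exact one_le_mul (one_le_bwt ν hs _ _) (one_le_bwt ν hs0 _ _)
  have hwtop (ℓ j q) : w ℓ j q ≠ ⊤ :=
    ENNReal.add_ne_top.2 ⟨ENNReal.mul_ne_top (bwt_ne_top _ _ _ _) (bwt_ne_top _ _ _ _),
      ENNReal.mul_ne_top (bwt_ne_top _ _ _ _) (bwt_ne_top _ _ _ _)⟩
  have hsum (ℓ : Fin ν → ℤ) (j : ℕ+) :
      bwt ν s ℓ (((j : ℕ) : ℤ) - ((j' : ℕ) : ℤ)) * ∑' q, (w ℓ j q)⁻¹ ≤ bcompConst ν s := by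
    rw [← ENNReal.tsum_mul_left]
    calc _ ≤ ∑' q, ENNReal.ofReal (2 ^ (2 * s)) *
            ((bB (s0 ν : ℕ) q)⁻¹ + (bR (s0 ν : ℕ) ℓ j q)⁻¹) := by
          refine ENNReal.tsum_le_tsum fun q => ?_
          have h := bwt_add_mul_inv_le ν hs (s0 ν : ℕ) (ℓ - q.1) q.1 (((j : ℕ) : ℤ) - ((q.2 : ℕ) : ℤ))
            (((q.2 : ℕ) : ℤ) - ((j' : ℕ) : ℤ))
          rwa [sub_add_cancel, sub_add_sub_cancel] at h
      _ ≤ bcompConst ν s := by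
          rw [ENNReal.tsum_mul_left, ENNReal.tsum_add, bcompConst, two_mul (tsum _)]
          gcongr
          · refine ENNReal.tsum_comp_le_tsum_of_injective
              (f := fun q : (Fin ν → ℤ) × ℕ+ => (q.1, ((q.2 : ℕ) : ℤ) - ((j' : ℕ) : ℤ))) ?_
              fun p : (Fin ν → ℤ) × ℤ => (bwt ν (s0 ν : ℕ) p.1 p.2)⁻¹
            rintro ⟨a, b⟩ ⟨c, d⟩ h
            simpa using h
          · refine ENNReal.tsum_comp_le_tsum_of_injective
              (f := fun q : (Fin ν → ℤ) × ℕ+ => (ℓ - q.1, ((j : ℕ) : ℤ) - ((q.2 : ℕ) : ℤ))) ?_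
              fun p : (Fin ν → ℤ) × ℤ => (bwt ν (s0 ν : ℕ) p.1 p.2)⁻¹
            rintro ⟨a, b⟩ ⟨c, d⟩ h
            simpa using h
  have hterm (ℓ : Fin ν → ℤ) (j : ℕ+) :
      bwt ν s ℓ (((j : ℕ) : ℤ) - ((j' : ℕ) : ℤ)) * frobSq (bcomp R B ℓ j j') ≤
        bcompConst ν s *
          (∑' q : (Fin ν → ℤ) × ℕ+, (bR s ℓ j q * frobSq (R (ℓ - q.1) j q.2)) *
              (bB (s0 ν : ℕ) q * frobSq (B q.1 q.2 j')) +
            ∑' q : (Fin ν → ℤ) × ℕ+, (bR (s0 ν : ℕ) ℓ j q * frobSq (R (ℓ - q.1) j q.2)) *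
              (bB s q * frobSq (B q.1 q.2 j'))) := by
    calc _ ≤ bwt ν s ℓ (((j : ℕ) : ℤ) - ((j' : ℕ) : ℤ)) * ((∑' q, (w ℓ j q)⁻¹) *
            ∑' q, w ℓ j q * frobSq (R (ℓ - q.1) j q.2 * B q.1 q.2 j')) := by
          gcongr
          exact frobSq_tsum_le _ (w ℓ j) (hw0 ℓ j) (hwtop ℓ j)
      _ ≤ bcompConst ν s *
            ∑' q, w ℓ j q * (frobSq (R (ℓ - q.1) j q.2) * frobSq (B q.1 q.2 j')) := by
          rw [← mul_assoc]
          gcongr with q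
          · exact hsum ℓ j
          · exact frobSq_mul_le _ _
      _ = _ := by
          rw [← ENNReal.tsum_add]
          congr 1
          refine tsum_congr fun q => ?_
          simp only [w]
          ring
  refine (ENNReal.tsum_le_tsum fun ℓ => ENNReal.tsum_le_tsum fun j => hterm ℓ j).trans ?_
  simp only [ENNReal.tsum_mul_left, ENNReal.tsum_add]
  gcongr
  · exact tsum_tsum_tsum_mul_le s (s0 ν : ℕ) R B j'
  · exact tsum_tsum_tsum_mul_le (s0 ν : ℕ) s R B j'

/-! ### Powers and the exponential -/

/-- Bound for the powers of a block operator in terms of any constant that dominates the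
composition constants at the two regularities `s` and `s₀`. -/
lemma sq_blockNorm_rD_bpowI_succ_le {ν : ℕ} {s : ℝ} (hs : 0 ≤ s) {A : ℝ≥0∞}
    (hA : 2 * bcompConst ν s ≤ A) (hA0 : 2 * bcompConst ν (s0 ν : ℕ) ≤ A) (Ψ : BlockOp ν) (n : ℕ) :
    blockNorm s (rD (bpowI Ψ (n + 1))) ^ 2 ≤
      A ^ n * (blockNorm (s0 ν : ℕ) (rD Ψ) ^ 2) ^ n * blockNorm s (rD Ψ) ^ 2 := by
  set X := blockNorm (s0 ν : ℕ) (rD Ψ) ^ 2 with hX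
  have hstep (r : ℝ) (hr : 0 ≤ r) (hAr : 2 * bcompConst ν r ≤ A) (n : ℕ)
      (h0 : blockNorm (s0 ν : ℕ) (rD (bpowI Ψ (n + 1))) ^ 2 ≤ A ^ n * X ^ n * X)
      (h : blockNorm r (rD (bpowI Ψ (n + 1))) ^ 2 ≤
        A ^ n * X ^ n * blockNorm r (rD Ψ) ^ 2) :
      blockNorm r (rD (bpowI Ψ (n + 1 + 1))) ^ 2 ≤
        A ^ (n + 1) * X ^ (n + 1) * blockNorm r (rD Ψ) ^ 2 := by
    rw [bpowI, rD_bcomp]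
    calc _ ≤ bcompConst ν r *
            (blockNorm r (rD Ψ) ^ 2 * (A ^ n * X ^ n * X) +
              X * (A ^ n * X ^ n * blockNorm r (rD Ψ) ^ 2)) := by
          refine (sq_blockNorm_bcomp_le hr Ψ _).trans ?_
          gcongr
          · exact blockNorm_le_blockNorm_rD r Ψ
          · rw [hX]
            gcongr
            exact blockNorm_le_blockNorm_rD _ Ψ
      _ = (2 * bcompConst ν r) * (A ^ n * X ^ (n + 1) * blockNorm r (rD Ψ) ^ 2) := by ring
      _ ≤ A * (A ^ n * X ^ (n + 1) * blockNorm r (rD Ψ) ^ 2) := by gcongr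
      _ = _ := by ring
  have hbase (r : ℝ) : blockNorm r (rD (bpowI Ψ (0 + 1))) ^ 2 ≤
      A ^ 0 * X ^ 0 * blockNorm r (rD Ψ) ^ 2 := by
    rw [bpowI, bpowI, bcomp_bId]
    simp
  have h0 (n : ℕ) : blockNorm (s0 ν : ℕ) (rD (bpowI Ψ (n + 1))) ^ 2 ≤ A ^ n * X ^ n * X := by
    induction n with
    | zero => exact hbase _
    | succ n ih => exact hstep _ (Nat.cast_nonneg _) hA0 n ih ih
  induction n with
  | zero => exact hbase s
  | succ n ih => exact hstep s hs hA n (h0 n) ih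

/-- The exponential series in the extended nonnegative reals. -/
noncomputable def expSeries (A : ℝ≥0∞) : ℝ≥0∞ := ∑' k : ℕ, (k.factorial : ℝ≥0∞)⁻¹ * A ^ k

lemma expSeries_ne_top {A : ℝ≥0∞} (hA : A ≠ ⊤) : expSeries A ≠ ⊤ := by
  lift A to ℝ≥0 using hA
  have h := (Real.summable_pow_div_factorial (A : ℝ)).tsum_ofReal_ne_top
  refine ne_of_eq_of_ne (tsum_congr fun k => ?_) h
  rw [ENNReal.ofReal_div_of_pos (by positivity), ENNReal.ofReal_pow (by positivity),
    ENNReal.ofReal_coe_nnreal, ENNReal.ofReal_natCast, ENNReal.div_eq_inv_mul]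

lemma one_le_expSeries (A : ℝ≥0∞) : 1 ≤ expSeries A :=
  le_trans (by simp) (ENNReal.le_tsum (f := fun k : ℕ => (k.factorial : ℝ≥0∞)⁻¹ * A ^ k) 0)

lemma tsum_inv_factorial_le {A : ℝ≥0∞} (hA : 1 ≤ A) (m : ℕ) :
    ∑' k : ℕ, ((k + m).factorial : ℝ≥0∞)⁻¹ ≤ expSeries A := by
  refine ENNReal.tsum_le_tsum fun k => ?_
  calc ((k + m).factorial : ℝ≥0∞)⁻¹ ≤ (k.factorial : ℝ≥0∞)⁻¹ := by
        gcongr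
        exact Nat.le_add_right k m
    _ ≤ _ := le_mul_of_one_le_right' (one_le_pow₀ hA)

lemma enorm_inv_factorial (k : ℕ) : ‖(k.factorial : ℂ)⁻¹‖ₑ = (k.factorial : ℝ≥0∞)⁻¹ := by
  rw [enorm_inv (by exact_mod_cast k.factorial_ne_zero), ← ofReal_norm, Complex.norm_natCast, ENNReal.ofReal_natCast]

/-- Tails of exponential-type series of block operators. -/
lemma colSq_tsum_inv_factorial_le {ν : ℕ} {s : ℝ} {A c : ℝ≥0∞} (hA : 1 ≤ A) (m : ℕ)
    (T : ℕ → BlockOp ν) (hT : ∀ k, blockNorm s (rD (T k)) ^ 2 ≤ A ^ k * c) (j' : ℕ+) :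
    colSq s (rD fun ℓ j j' => ∑' k : ℕ, (((k + m).factorial : ℂ)⁻¹) • T k ℓ j j') j' ≤
      expSeries A ^ 2 * c := by
  have hfrob (ℓ : Fin ν → ℤ) (j : ℕ+) :
      frobSq (rD (fun ℓ j j' => ∑' k : ℕ, (((k + m).factorial : ℂ)⁻¹) • T k ℓ j j') ℓ j j') ≤
        expSeries A * ∑' k : ℕ, ((k + m).factorial : ℝ≥0∞)⁻¹ * frobSq (rD (T k) ℓ j j') := by
    have hrw : rD (fun ℓ j j' => ∑' k : ℕ, (((k + m).factorial : ℂ)⁻¹) • T k ℓ j j') ℓ j j' =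
        ∑' k : ℕ, (((k + m).factorial : ℂ)⁻¹) • rD (T k) ℓ j j' := by
      simp only [rD]
      rw [← tsum_const_smul'']
      exact tsum_congr fun k => smul_comm _ _ _
    have hne (k : ℕ) : ((k + m).factorial : ℝ≥0∞) ≠ 0 := by
      exact_mod_cast (k + m).factorial_ne_zero
    rw [hrw]
    refine (frobSq_tsum_le _ (fun k => ((k + m).factorial : ℝ≥0∞)) hne
      fun k => ENNReal.natCast_ne_top _).trans ?_
    refine mul_le_mul' (tsum_inv_factorial_le hA m) (ENNReal.tsum_le_tsum fun k => ?_)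
    rw [frobSq_smul, enorm_inv_factorial, sq, ← mul_assoc, ← mul_assoc,
      ENNReal.mul_inv_cancel (hne k) (ENNReal.natCast_ne_top _), one_mul]
  calc _ ≤ ∑' ℓ : Fin ν → ℤ, ∑' j : ℕ+, expSeries A * ∑' k : ℕ, ((k + m).factorial : ℝ≥0∞)⁻¹ *
          (bwt ν s ℓ (((j : ℕ) : ℤ) - ((j' : ℕ) : ℤ)) * frobSq (rD (T k) ℓ j j')) := by
        refine ENNReal.tsum_le_tsum fun ℓ => ENNReal.tsum_le_tsum fun j => ?_
        refine (mul_le_mul_right (hfrob ℓ j) _).trans_eq ?_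
        rw [mul_left_comm, ← ENNReal.tsum_mul_left]
        simp only [mul_left_comm]
    _ = expSeries A * ∑' k : ℕ, ((k + m).factorial : ℝ≥0∞)⁻¹ * colSq s (rD (T k)) j' := by
        simp only [ENNReal.tsum_mul_left]
        congr 1
        refine (tsum_congr fun ℓ => ENNReal.tsum_comm).trans (ENNReal.tsum_comm.trans
          (tsum_congr fun q => ?_))
        simp only [ENNReal.tsum_mul_left, colSq]
    _ ≤ expSeries A * ∑' k : ℕ, ((k.factorial : ℝ≥0∞)⁻¹ * A ^ k) * c := by
        refine mul_le_mul_right (ENNReal.tsum_le_tsum fun k => ?_) _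
        rw [mul_assoc]
        gcongr
        · exact Nat.le_add_right k m
        · exact (colSq_le_sq_blockNorm s _ j').trans (hT k)
    _ = _ := by
        rw [ENNReal.tsum_mul_right, ← expSeries]
        ring

/-- The exponential series converges blockwise as soon as the powers grow at most
geometrically. -/
lemma summable_inv_factorial_smul_bpowI {ν : ℕ} {s : ℝ} (hs : 0 ≤ s) {A c : ℝ≥0∞} (hA : 1 ≤ A)
    (hAtop : A ≠ ⊤) (hc : c ≠ ⊤) (Ψ : BlockOp ν)
    (hT : ∀ k, blockNorm s (rD (bpowI Ψ (k + 1))) ^ 2 ≤ A ^ k * c)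
    (ℓ : Fin ν → ℤ) (j j' : ℕ+) :
    Summable fun k : ℕ => ((k.factorial : ℂ)⁻¹) • bpowI Ψ k ℓ j j' := by
  rw [← summable_nat_add_iff 1]
  refine Pi.summable.2 fun a => Pi.summable.2 fun b => ?_
  have hsq : (∑' k : ℕ, ‖((((k + 1).factorial : ℂ)⁻¹) • bpowI Ψ (k + 1) ℓ j j') a b‖ₑ) ^ 2 ≤
      expSeries A * (expSeries A * c) := by
    refine (ENNReal.sq_tsum_le_of_sq_le_mul (f := fun k => ((k + 1).factorial : ℝ≥0∞)⁻¹)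
      (g := fun k => (k.factorial : ℝ≥0∞)⁻¹ * A ^ k * c) fun k => ?_).trans ?_
    · rw [Matrix.smul_apply, smul_eq_mul, enorm_mul, enorm_inv_factorial, mul_pow, sq, mul_assoc,
        mul_assoc _ _ c]
      gcongr
      · exact Nat.le_add_right k 1
      · calc _ ≤ frobSq (bpowI Ψ (k + 1) ℓ j j') := enorm_sq_le_frobSq _ a b
          _ ≤ frobSq (rD (bpowI Ψ (k + 1)) ℓ j j') := frobSq_le_frobSq_rD _ _ _ _
          _ ≤ colSq s (rD (bpowI Ψ (k + 1))) j' := frobSq_le_colSq hs _ _ _ _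
          _ ≤ A ^ k * c := (colSq_le_sq_blockNorm s _ j').trans (hT k)
    · rw [ENNReal.tsum_mul_right, ← expSeries]
      gcongr
      exact tsum_inv_factorial_le hA 1
  refine Summable.of_enorm fun htop => ?_
  refine ne_top_of_le_ne_top ?_ hsq ?_
  · have hE := expSeries_ne_top hAtop
    exact ENNReal.mul_ne_top hE (ENNReal.mul_ne_top hE hc)
  · exact ENNReal.pow_eq_top_iff.2 ⟨htop, two_ne_zero⟩

lemma bexp_sub_bId_eq {ν : ℕ} {Ψ : BlockOp ν}
    (hsum : ∀ ℓ j j', Summable fun k : ℕ => ((k.factorial : ℂ)⁻¹) • bpowI Ψ k ℓ j j') :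
    bsub (bexp Ψ) (bId ν) =
      fun ℓ j j' => ∑' k : ℕ, (((k + 1).factorial : ℂ)⁻¹) • bpowI Ψ (k + 1) ℓ j j' := by
  funext ℓ j j'
  rw [bsub, bexp, (hsum ℓ j j').tsum_eq_zero_add]
  simp [bpowI]

lemma bexp_sub_bId_sub_eq {ν : ℕ} {Ψ : BlockOp ν}
    (hsum : ∀ ℓ j j', Summable fun k : ℕ => ((k.factorial : ℂ)⁻¹) • bpowI Ψ k ℓ j j') :
    bsub (bsub (bexp Ψ) (bId ν)) Ψ =
      fun ℓ j j' => ∑' k : ℕ, (((k + 2).factorial : ℂ)⁻¹) • bpowI Ψ (k + 2) ℓ j j' := by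
  rw [bexp_sub_bId_eq hsum]
  funext ℓ j j'
  rw [bsub, ((summable_nat_add_iff 1).2 (hsum ℓ j j')).tsum_eq_zero_add]
  simp [bpowI, bcomp_bId]

/-- Estimates for the exponential of an operator in block-decay norm
(Lemma 2.10, (2.31) and (2.33)): if `|Ψ|D||_{s₀} ≤ 1` and `|Ψ|D||_s < ∞`, then
`|(exp(Ψ) − Id)|D||_s ≤ C |Ψ|D||_s` and
`|(exp(Ψ) − Id − Ψ)|D||_s ≤ C |Ψ|D||_s · |Ψ|D||_{s₀}`. -/
theorem blockNorm_bexp (ν : ℕ) (hν : 1 ≤ ν) (s : ℝ) (hs : ((s0 ν : ℕ) : ℝ) ≤ s) :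
    ∃ C : ℝ≥0∞, 0 < C ∧ C < ⊤ ∧ ∀ Ψ : BlockOp ν,
      blockNorm ((s0 ν : ℕ) : ℝ) (rD Ψ) ≤ 1 → blockNorm s (rD Ψ) < ⊤ →
      blockNorm s (rD (bsub (bexp Ψ) (bId ν))) ≤ C * blockNorm s (rD Ψ) ∧
      blockNorm s (rD (bsub (bsub (bexp Ψ) (bId ν)) Ψ)) ≤
        C * blockNorm s (rD Ψ) * blockNorm ((s0 ν : ℕ) : ℝ) (rD Ψ) := by
  have hs0 : 0 ≤ s := (Nat.cast_nonneg _).trans hs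
  set A : ℝ≥0∞ := 1 + 2 * bcompConst ν s + 2 * bcompConst ν (s0 ν : ℕ) with hAdef
  have hA1 : 1 ≤ A := le_add_right le_self_add
  have hAtop : A ≠ ⊤ := by
    simp [hAdef, ENNReal.mul_ne_top, bcompConst_ne_top]
  have hE1 : 1 ≤ expSeries A := one_le_expSeries A
  have hEtop : expSeries A ≠ ⊤ := expSeries_ne_top hAtop
  have hC1 : 1 ≤ expSeries A * A := one_le_mul hE1 hA1
  refine ⟨expSeries A * A, zero_lt_one.trans_le hC1, (ENNReal.mul_ne_top hEtop hAtop).lt_top,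
    fun Ψ hΨ hΨs => ?_⟩
  have hpow := sq_blockNorm_rD_bpowI_succ_le hs0 (A := A)
    (le_add_right le_add_self) le_add_self Ψ
  set x := blockNorm (s0 ν : ℕ) (rD Ψ)
  set y := blockNorm s (rD Ψ)
  have hx (n : ℕ) : (x ^ 2) ^ n ≤ 1 := pow_le_one' (pow_le_one' hΨ 2) n
  have hpow1 (k : ℕ) : blockNorm s (rD (bpowI Ψ (k + 1))) ^ 2 ≤ A ^ k * y ^ 2 :=
    (hpow k).trans (by gcongr; exact mul_le_of_le_one_right' (hx k))
  have hpow2 (k : ℕ) : blockNorm s (rD (bpowI Ψ (k + 2))) ^ 2 ≤ A ^ k * (A * x ^ 2 * y ^ 2) :=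
    calc _ ≤ A ^ (k + 1) * (x ^ 2) ^ (k + 1) * y ^ 2 := hpow (k + 1)
      _ = A ^ k * (A * ((x ^ 2) ^ k * x ^ 2) * y ^ 2) := by ring
      _ ≤ _ := by gcongr; exact mul_le_of_le_one_left' (hx k)
  have hsum := summable_inv_factorial_smul_bpowI hs0 hA1 hAtop
    (ENNReal.pow_ne_top hΨs.ne) Ψ hpow1
  constructor
  · rw [bexp_sub_bId_eq hsum]
    refine blockNorm_le_iff.2 fun j' =>
      (colSq_tsum_inv_factorial_le hA1 1 _ hpow1 j').trans ?_
    rw [mul_pow]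
    gcongr
    exact le_mul_of_one_le_right' hA1
  · rw [bexp_sub_bId_sub_eq hsum]
    refine blockNorm_le_iff.2 fun j' =>
      (colSq_tsum_inv_factorial_le hA1 2 _ hpow2 j').trans ?_
    calc expSeries A ^ 2 * (A * x ^ 2 * y ^ 2)
        ≤ expSeries A ^ 2 * (A ^ 2 * x ^ 2 * y ^ 2) := by
          gcongr
          exact le_self_pow₀ hA1 two_ne_zero
      _ = _ := by ring
end

section
/- Evaluation in the time variable and the space block-decay norm (Lemma 2.13(ii)): Let ν ≥ 1 and s ≥ 0, and set s₀ := ⌊(ν+1)/2⌋ + 1. There exists a constant C = C(ν) > 0 such that for every Töplitz-in-time 2×2 block operator R with |R|_{s+s₀} < ∞ and every φ ∈ ℝ^ν, the family of blocks R(φ)(j, j') := ∑_{ℓ ∈ ℤ^ν} R(ℓ, j, j') e^{i ℓ·φ} (the series converging absolutely) satisfies |R(φ)|_{s,x} := sup_{j' ∈ ℕ₊} (∑_{j ∈ ℕ₊} ⟨j − j'⟩^{2s} ‖R(φ)(j, j')‖²)^{1/2} ≤ C |R|_{s+s₀}, where ⟨m⟩ := max(1, |m|). -/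
open scoped ENNReal NNReal BigOperators

/-- Evaluation of a Töplitz-in-time operator at the time variable `φ`:
`R(φ)(j, j') = ∑_ℓ R(ℓ, j, j') e^{i ℓ·φ}`. -/
noncomputable def beval {ν : ℕ} (R : BlockOp ν) (φ : Fin ν → ℝ) :
    ℕ+ → ℕ+ → Matrix (Fin 2) (Fin 2) ℂ :=
  fun j j' => ∑' ℓ : Fin ν → ℤ,
    Complex.exp (Complex.I * ((∑ i, (ℓ i : ℝ) * φ i : ℝ) : ℂ)) • R ℓ j j'

/-- The space block-decay norm
`|T|_{s,x} = sup_{j'} (∑_j ⟨j − j'⟩^{2s} ‖T(j, j')‖²)^{1/2}` (valued in `ℝ≥0∞`). -/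
noncomputable def spaceBlockNorm (ν : ℕ) (s : ℝ)
    (T : ℕ+ → ℕ+ → Matrix (Fin 2) (Fin 2) ℂ) : ℝ≥0∞ :=
  ⨆ j' : ℕ+, (∑' j : ℕ+,
    bwt ν s 0 (((j : ℕ) : ℤ) - ((j' : ℕ) : ℤ)) * frobSq (T j j')) ^ (1/2 : ℝ)

/-- `p`-series on `ℤ^ν`: the inverse time weights are summable as soon as `ν < 2 * r`. -/
lemma tsum_inv_bwt_ne_top {ν : ℕ} {r : ℝ} (hr : (ν : ℝ) < 2 * r) :
    ∑' ℓ : Fin ν → ℤ, (bwt ν r ℓ 0)⁻¹ ≠ ⊤ := by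
  let b := Pi.basisFun ℝ (Fin ν)
  let L : Submodule ℤ (Fin ν → ℝ) := Submodule.span ℤ (Set.range b)
  let e : L ≃ₗ[ℤ] (Fin ν → ℤ) := (b.restrictScalars ℤ).equivFun
  have he (ℓ : Fin ν → ℤ) : ‖e.symm ℓ‖ = ‖ℓ‖ := by
    have hcoe : ((e.symm ℓ : L) : Fin ν → ℝ) = fun i => (ℓ i : ℝ) := by
      ext i
      simp [e, b, L, Module.Basis.equivFun_symm_apply, Module.Basis.restrictScalars_apply,
        Pi.single_apply]
    rw [← Submodule.norm_coe, hcoe]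
    simp only [Pi.norm_def, nnnorm, Int.norm_cast_real]
  have hfin : Module.finrank ℤ L = ν := by
    rw [Module.finrank_eq_card_basis (b.restrictScalars ℤ), Fintype.card_fin]
  have hsum : Summable fun ℓ : Fin ν → ℤ => ‖ℓ‖ ^ (-(2 * r)) := by
    have h := ZLattice.summable_norm_rpow L (-(2 * r)) (by rw [hfin]; linarith)
    exact (e.symm.toEquiv.summable_iff.mpr h).congr fun ℓ => by
      rw [Function.comp_apply, LinearEquiv.coe_toEquiv, he]
  have hsum' : Summable fun ℓ : Fin ν → ℤ => (max 1 ‖ℓ‖) ^ (-(2 * r)) := by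
    refine hsum.congr_cofinite ?_
    filter_upwards [(Set.finite_singleton (0 : Fin ν → ℤ)).compl_mem_cofinite] with ℓ hℓ
    obtain ⟨i, hi⟩ := Function.ne_iff.mp (show ℓ ≠ 0 from hℓ)
    have hone : (1 : ℝ) ≤ ‖ℓ‖ := by
      refine le_trans ?_ (norm_le_pi_norm ℓ i)
      rw [Int.norm_eq_abs]
      exact_mod_cast Int.one_le_abs hi
    rw [max_eq_right hone]
  refine ne_of_eq_of_ne (tsum_congr fun ℓ => ?_) hsum'.tsum_ofReal_ne_top
  rw [bwt, ← ENNReal.ofReal_inv_of_pos (by positivity), Real.rpow_neg (by positivity)]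
  simp

lemma bwt_ne_zero (ν : ℕ) (s : ℝ) (ℓ : Fin ν → ℤ) (m : ℤ) : bwt ν s ℓ m ≠ 0 := by
  rw [bwt, ENNReal.ofReal_ne_zero_iff]
  positivity

/-- The weight in `(ℓ, m)` dominates the product of the space weight and the time weight. -/
lemma bwt_mul_bwt_le {ν : ℕ} {s r : ℝ} (hs : 0 ≤ s) (hr : 0 ≤ r) (ℓ : Fin ν → ℤ) (m : ℤ) :
    bwt ν s 0 m * bwt ν r ℓ 0 ≤ bwt ν (s + r) ℓ m := by
  rw [bwt, bwt, bwt, ← ENNReal.ofReal_mul (by positivity), mul_add, Real.rpow_add (by positivity)]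
  refine ENNReal.ofReal_le_ofReal ?_
  have hspace : max 1 (max ‖(0 : Fin ν → ℤ)‖ ((|m| : ℤ) : ℝ)) ≤ max 1 (max ‖ℓ‖ ((|m| : ℤ) : ℝ)) :=
    max_le_max_left _ (max_le_max_right _ (by simp))
  have htime : max 1 (max ‖ℓ‖ ((|(0 : ℤ)| : ℤ) : ℝ)) ≤ max 1 (max ‖ℓ‖ ((|m| : ℤ) : ℝ)) :=
    max_le_max_left _ (max_le_max_left _ (by simp))
  exact mul_le_mul (Real.rpow_le_rpow (by positivity) hspace (by positivity))
    (Real.rpow_le_rpow (by positivity) htime (by positivity)) (by positivity) (by positivity)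

/-- Weighted Cauchy–Schwarz inequality for series in `ℝ≥0∞`. -/
lemma ENNReal.sq_tsum_le_tsum_inv_mul_tsum {ι : Type*} (w f : ι → ℝ≥0∞)
    (hw₀ : ∀ i, w i ≠ 0) (hw : ∀ i, w i ≠ ⊤) :
    (∑' i, f i) ^ 2 ≤ (∑' i, (w i)⁻¹) * ∑' i, w i * f i ^ 2 := by
  let _ : MeasurableSpace ι := ⊤
  have hpq : (2 : ℝ).HolderConjugate 2 := Real.HolderConjugate.two_two
  have h := ENNReal.lintegral_mul_le_Lp_mul_Lq MeasureTheory.Measure.count hpq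
    (f := fun i => (w i)⁻¹ ^ (1 / 2 : ℝ)) (g := fun i => w i ^ (1 / 2 : ℝ) * f i)
    measurable_from_top.aemeasurable measurable_from_top.aemeasurable
  have hprod (i : ι) : (w i)⁻¹ ^ (1 / 2 : ℝ) * (w i ^ (1 / 2 : ℝ) * f i) = f i := by
    rw [← mul_assoc, ← ENNReal.mul_rpow_of_nonneg _ _ (by norm_num),
      ENNReal.inv_mul_cancel (hw₀ i) (hw i), ENNReal.one_rpow, one_mul]
  have hhalf (x : ℝ≥0∞) : (x ^ (1 / 2 : ℝ)) ^ 2 = x := by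
    rw [← ENNReal.rpow_natCast, ← ENNReal.rpow_mul]
    norm_num
  simp only [MeasureTheory.lintegral_count, Pi.mul_apply, hprod, ENNReal.rpow_two, mul_pow,
    hhalf] at h
  calc (∑' i, f i) ^ 2
      ≤ ((∑' i, (w i)⁻¹) ^ (1 / 2 : ℝ) * (∑' i, w i * f i ^ 2) ^ (1 / 2 : ℝ)) ^ 2 := by gcongr
    _ = _ := by rw [mul_pow, hhalf, hhalf]

/-- Entrywise bound for the evaluated operator; it also holds, trivially, when the series defining
the evaluation diverges. -/
lemma enorm_beval_apply_le {ν : ℕ} (R : BlockOp ν) (φ : Fin ν → ℝ) (j j' : ℕ+) (a b : Fin 2) :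
    ‖beval R φ j j' a b‖ₑ ≤ ∑' ℓ, ‖R ℓ j j' a b‖ₑ := by
  by_cases h : Summable fun ℓ : Fin ν → ℤ =>
      Complex.exp (Complex.I * ((∑ i, (ℓ i : ℝ) * φ i : ℝ) : ℂ)) • R ℓ j j'
  · have happ : beval R φ j j' a b = ∑' ℓ : Fin ν → ℤ,
        Complex.exp (Complex.I * ((∑ i, (ℓ i : ℝ) * φ i : ℝ) : ℂ)) * R ℓ j j' a b := by
      have hent := Pi.hasSum.mp (Pi.hasSum.mp h.hasSum a) b
      exact hent.tsum_eq.symm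
    rw [happ]
    refine enorm_tsum_le_tsum_enorm.trans_eq (tsum_congr fun ℓ => ?_)
    rw [enorm_mul, Complex.enorm_exp_I_mul_ofReal, one_mul]
  · rw [beval, tsum_eq_zero_of_not_summable h]
    simp

lemma frobSq_beval_le {ν : ℕ} (r : ℝ) (R : BlockOp ν) (φ : Fin ν → ℝ) (j j' : ℕ+) :
    frobSq (beval R φ j j') ≤
      (∑' ℓ : Fin ν → ℤ, (bwt ν r ℓ 0)⁻¹) * ∑' ℓ, bwt ν r ℓ 0 * frobSq (R ℓ j j') := by
  calc frobSq (beval R φ j j')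
      ≤ ∑ a, ∑ b, (∑' ℓ : Fin ν → ℤ, (bwt ν r ℓ 0)⁻¹) *
          ∑' ℓ, bwt ν r ℓ 0 * ‖R ℓ j j' a b‖ₑ ^ 2 := by
        refine Finset.sum_le_sum fun a _ => Finset.sum_le_sum fun b _ => ?_
        exact (pow_le_pow_left' (enorm_beval_apply_le R φ j j' a b) 2).trans
          (ENNReal.sq_tsum_le_tsum_inv_mul_tsum _ _ (fun ℓ => bwt_ne_zero ν r ℓ 0)
            fun ℓ => bwt_ne_top ν r ℓ 0)
    _ = _ := by
        simp only [frobSq, Fin.sum_univ_two, mul_add, ENNReal.tsum_add]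
        rfl

lemma lt_two_mul_s0 (ν : ℕ) : (ν : ℝ) < 2 * (s0 ν : ℝ) := by
  have : ν < 2 * s0 ν := by unfold s0; omega
  exact_mod_cast this

/-- Evaluation in the time variable and the space block-decay norm (Lemma 2.13(ii)):
`|R(φ)|_{s,x} ≤ C(ν) |R|_{s+s₀}`. -/
theorem spaceBlockNorm_beval (ν : ℕ) (hν : 1 ≤ ν) :
    ∃ C : ℝ≥0∞, 0 < C ∧ C < ⊤ ∧
      ∀ (s : ℝ), 0 ≤ s → ∀ R : BlockOp ν, blockNorm (s + ((s0 ν : ℕ) : ℝ)) R < ⊤ →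
        ∀ φ : Fin ν → ℝ,
          spaceBlockNorm ν s (beval R φ) ≤ C * blockNorm (s + ((s0 ν : ℕ) : ℝ)) R := by
  set K : ℝ≥0∞ := ∑' ℓ : Fin ν → ℤ, (bwt ν (s0 ν) ℓ 0)⁻¹
  have hK_top : K ≠ ⊤ := tsum_inv_bwt_ne_top (lt_two_mul_s0 ν)
  have hK_pos : 0 < K :=
    (ENNReal.inv_pos.mpr (bwt_ne_top ν (s0 ν) 0 0)).trans_le
      (ENNReal.le_tsum (f := fun ℓ => (bwt ν (s0 ν) ℓ 0)⁻¹) 0)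
  refine ⟨K ^ (1 / 2 : ℝ), ENNReal.rpow_pos hK_pos hK_top,
    ENNReal.rpow_lt_top_of_nonneg (by norm_num) hK_top, fun s hs R _ φ => iSup_le fun j' => ?_⟩
  have hcol : ∑' j : ℕ+, bwt ν s 0 (((j : ℕ) : ℤ) - ((j' : ℕ) : ℤ)) * frobSq (beval R φ j j') ≤
      K * ∑' ℓ : Fin ν → ℤ, ∑' j : ℕ+,
        bwt ν (s + (s0 ν : ℝ)) ℓ (((j : ℕ) : ℤ) - ((j' : ℕ) : ℤ)) * frobSq (R ℓ j j') := by
    rw [ENNReal.tsum_comm, ← ENNReal.tsum_mul_left]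
    refine ENNReal.tsum_le_tsum fun j => ?_
    grw [frobSq_beval_le (s0 ν) R φ j j']
    rw [mul_left_comm, ← ENNReal.tsum_mul_left]
    refine mul_le_mul_right (ENNReal.tsum_le_tsum fun ℓ => ?_) K
    rw [← mul_assoc]
    gcongr
    exact bwt_mul_bwt_le hs (Nat.cast_nonneg _) ℓ _
  grw [hcol]
  rw [ENNReal.mul_rpow_of_nonneg _ _ (by norm_num)]
  gcongr
  exact le_iSup (fun j' : ℕ+ => (∑' ℓ : Fin ν → ℤ, ∑' j : ℕ+,
    bwt ν (s + (s0 ν : ℝ)) ℓ (((j : ℕ) : ℤ) - ((j' : ℕ) : ℤ)) * frobSq (R ℓ j j')) ^ (1 / 2 : ℝ)) j'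
end
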